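/- arXiv:1701.07757 — 4 statements merged into one kernel-verified Lean document; each statement's English description precedes it below -/
import Mathlib

section
/- Let ρ = (1/3)(|00⟩⟨00| + |01⟩⟨01| + |10⟩⟨10|) on ℂ² ⊗ ℂ². Then ρ is separable, and for every ε > 0 there exists an entangled state σ on ℂ² ⊗ ℂ² with δ(ρ, σ) ≤ ε. -/
open Matrix Kronecker BigOperators
open scoped ComplexOrder

noncomputable section

/-- A quantum state: positive semidefinite, trace one. -/
def IsState {n : Type*} [Fintype n] [DecidableEq n] (ρ : Matrix n n ℂ) : Prop :=
  ρ.PosSemidef ∧ ρ.trace = 1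

/-- Separability on a bipartite system `ℂ^dA ⊗ ℂ^dB`. -/
def SeparableState {dA dB : ℕ} (ρ : Matrix (Fin dA × Fin dB) (Fin dA × Fin dB) ℂ) : Prop :=
  ∃ (m : ℕ) (p : Fin m → ℝ) (A : Fin m → Matrix (Fin dA) (Fin dA) ℂ)
    (B : Fin m → Matrix (Fin dB) (Fin dB) ℂ),
    (∀ k, 0 ≤ p k) ∧ (∑ k, p k) = 1 ∧ (∀ k, IsState (A k)) ∧ (∀ k, IsState (B k)) ∧
    ρ = ∑ k, ((p k : ℂ) • (A k ⊗ₖ B k))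

/-- An entangled state is a state that is not separable. -/
def EntangledState {dA dB : ℕ} (ρ : Matrix (Fin dA × Fin dB) (Fin dA × Fin dB) ℂ) : Prop :=
  IsState ρ ∧ ¬ SeparableState ρ

/-- Trace distance: half the sum of absolute values of the eigenvalues of `ρ - τ`. -/
def traceDist {n : Type*} [Fintype n] [DecidableEq n] (ρ τ : Matrix n n ℂ) : ℝ :=
  if h : (ρ - τ).IsHermitian then (1/2) * ∑ i, |h.eigenvalues i| else 0

/-- Standard basis vector of `ℂ^d`. -/
def bv {d : ℕ} (a : ℕ) (h : a < d) : Fin d → ℂ := Pi.single ⟨a, h⟩ (1 : ℂ)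

/-- Standard basis of `ℂ²`. -/
def ket2 (a : Fin 2) : Fin 2 → ℂ := Pi.single a 1

/-- Standard basis of `ℂ³`. -/
def ket3 (a : Fin 3) : Fin 3 → ℂ := Pi.single a 1

/-- `|+⟩ = (|0⟩+|1⟩)/√2`. -/
def ketPlus : Fin 2 → ℂ := (Real.sqrt 2 : ℂ)⁻¹ • (ket2 0 + ket2 1)

/-- `|−⟩ = (|0⟩−|1⟩)/√2`. -/
def ketMinus : Fin 2 → ℂ := (Real.sqrt 2 : ℂ)⁻¹ • (ket2 0 - ket2 1)

/-- Kronecker product of vectors. -/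
def vecKron {dA dB : ℕ} (v : Fin dA → ℂ) (w : Fin dB → ℂ) : Fin dA × Fin dB → ℂ :=
  fun p => v p.1 * w p.2

/-- `|ψ₊⟩ = (|01⟩+|10⟩)/√2`. -/
def psiPlus : Fin 2 × Fin 2 → ℂ :=
  (Real.sqrt 2 : ℂ)⁻¹ • (vecKron (ket2 0) (ket2 1) + vecKron (ket2 1) (ket2 0))

/-- `|φ₊⟩ = (|00⟩+|11⟩)/√2`. -/
def phiPlus : Fin 2 × Fin 2 → ℂ :=
  (Real.sqrt 2 : ℂ)⁻¹ • (vecKron (ket2 0) (ket2 0) + vecKron (ket2 1) (ket2 1))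

/-- The projector `|v⟩⟨v|`. -/
def proj {n : Type*} (v : n → ℂ) : Matrix n n ℂ := vecMulVec v (star v)

/-- Partial transpose on the first factor. -/
def PT {dA dB : ℕ} (ρ : Matrix (Fin dA × Fin dB) (Fin dA × Fin dB) ℂ) :
    Matrix (Fin dA × Fin dB) (Fin dA × Fin dB) ℂ :=
  Matrix.of fun p q => ρ (q.1, p.2) (p.1, q.2)

/-- `⟨v|M|w⟩`. -/
def braket {n : Type*} [Fintype n] (v : n → ℂ) (M : Matrix n n ℂ) (w : n → ℂ) : ℂ :=
  star v ⬝ᵥ (M *ᵥ w)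

/-- A state is classical with respect to the family of vectors `v` on the `A` side. -/
def ClassicalWrt {dA dB : ℕ} (v : Fin dA → Fin dA → ℂ)
    (ρ : Matrix (Fin dA × Fin dB) (Fin dA × Fin dB) ℂ) : Prop :=
  ∃ (lam : Fin dA → ℝ) (τ : Fin dA → Matrix (Fin dB) (Fin dB) ℂ),
    (∀ i, 0 ≤ lam i) ∧ (∀ i, IsState (τ i)) ∧
    ρ = ∑ i, ((lam i : ℂ) • (proj (v i) ⊗ₖ τ i))

/-- Orthonormality of a family of `dA` vectors of `ℂ^dA` (hence an orthonormal basis). -/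
def IsONBasis {d : ℕ} (v : Fin d → Fin d → ℂ) : Prop :=
  ∀ i j, star (v i) ⬝ᵥ v j = if i = j then 1 else 0

/-- A state is classical with respect to `A` if it is classical w.r.t. some
orthonormal basis of `ℂ^dA`; otherwise it is discordant. -/
def ClassicalA {dA dB : ℕ} (ρ : Matrix (Fin dA × Fin dB) (Fin dA × Fin dB) ℂ) : Prop :=
  ∃ v : Fin dA → Fin dA → ℂ, IsONBasis v ∧ ClassicalWrt v ρ

/-- Hamming weight of a natural number (number of ones in binary). -/
def hammingWt (n : ℕ) : ℕ := (Nat.digits 2 n).sum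

lemma posSemidef_proj {n : Type*} [Fintype n] [DecidableEq n] (v : n → ℂ) :
    (proj v).PosSemidef :=
  Matrix.posSemidef_vecMulVec_self_star v

lemma isState_proj_ket2 (a : Fin 2) : IsState (proj (ket2 a)) := by
  refine ⟨posSemidef_proj _, ?_⟩
  fin_cases a <;> simp [proj, ket2, Matrix.trace, vecMulVec_apply]

lemma proj_vecKron {dA dB : ℕ} (v : Fin dA → ℂ) (w : Fin dB → ℂ) :
    proj (vecKron v w) = proj v ⊗ₖ proj w := by
  ext p q
  simp only [proj, vecKron, vecMulVec_apply, Pi.star_apply, kroneckerMap_apply, star_mul']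
  ring

lemma PosSemidef.offDiag_eq_zero {A : Matrix (Fin 2) (Fin 2) ℂ} (hA : A.PosSemidef)
    (h : A 1 1 = 0) : A 0 1 = 0 ∧ A 1 0 = 0 := by
  have hd := hA.det_nonneg
  have hs : A 1 0 = star (A 0 1) := (hA.1.apply 1 0).symm
  rw [det_fin_two, h, mul_zero, zero_sub, hs, Complex.star_def, Complex.mul_conj,
    neg_nonneg] at hd
  have h0 : A 0 1 = 0 :=
    Complex.normSq_eq_zero.mp (le_antisymm (by exact_mod_cast hd) (Complex.normSq_nonneg _))
  exact ⟨h0, by rw [hs, h0, star_zero]⟩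

/-- A separable two-qubit state with no weight on `|11⟩` has no `|01⟩⟨10|` coherence. -/
lemma SeparableState.coherence_eq_zero {σ : Matrix (Fin 2 × Fin 2) (Fin 2 × Fin 2) ℂ}
    (hσ : SeparableState σ) (h : σ (1, 1) (1, 1) = 0) : σ (0, 1) (1, 0) = 0 := by
  obtain ⟨m, p, A, B, hp, -, hA, hB, rfl⟩ := hσ
  simp only [Matrix.sum_apply, Matrix.smul_apply, kroneckerMap_apply, smul_eq_mul] at h ⊢
  have hnonneg : ∀ k ∈ Finset.univ, 0 ≤ (p k : ℂ) * (A k 1 1 * B k 1 1) := fun k _ =>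
    mul_nonneg (by exact_mod_cast hp k)
      (mul_nonneg (hA k).1.diag_nonneg (hB k).1.diag_nonneg)
  refine Finset.sum_eq_zero fun k hk => ?_
  have hk0 := (Finset.sum_eq_zero_iff_of_nonneg hnonneg).mp h k hk
  rcases mul_eq_zero.mp hk0 with h0 | h0
  · rw [h0, zero_mul]
  · rcases mul_eq_zero.mp h0 with h0 | h0
    · rw [(PosSemidef.offDiag_eq_zero (hA k).1 h0).1, zero_mul, mul_zero]
    · rw [(PosSemidef.offDiag_eq_zero (hB k).1 h0).2, mul_zero, mul_zero]

/-- Gershgorin bound on the trace distance. -/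
lemma traceDist_le_of_row_sum_le {n : Type*} [Fintype n] [DecidableEq n] {ρ τ : Matrix n n ℂ}
    {c : ℝ} (hc : 0 ≤ c) (h : ∀ i, ∑ j, ‖(ρ - τ) i j‖ ≤ c) :
    traceDist ρ τ ≤ (1 / 2) * (Fintype.card n * c) := by
  unfold traceDist
  split_ifs with hH
  · have hle : ∀ i, |hH.eigenvalues i| ≤ c := by
      intro i
      have hev : Module.End.HasEigenvalue (Matrix.toLin' (ρ - τ)) (hH.eigenvalues i : ℂ) := by
        refine Module.End.hasEigenvalue_of_hasEigenvector
          (x := (hH.eigenvectorBasis i).ofLp) ⟨?_, ?_⟩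
        · rw [Module.End.mem_eigenspace_iff, Matrix.toLin'_apply]
          exact hH.mulVec_eigenvectorBasis i
        · intro h0
          exact hH.eigenvectorBasis.orthonormal.ne_zero i
            ((WithLp.ofLp_eq_zero 2).mp h0)
      obtain ⟨k, hk⟩ := eigenvalue_mem_ball hev
      rw [mem_closedBall_iff_norm] at hk
      have hsum := Finset.add_sum_erase Finset.univ (fun j => ‖(ρ - τ) k j‖) (Finset.mem_univ k)
      have htri := norm_le_norm_add_norm_sub' (hH.eigenvalues i : ℂ) ((ρ - τ) k k)
      rw [Complex.norm_real, Real.norm_eq_abs] at htri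
      have := h k
      linarith
    have := Finset.sum_le_card_nsmul Finset.univ _ c fun i _ => hle i
    rw [Finset.card_univ, nsmul_eq_mul] at this
    gcongr
  · positivity

/-- The state `(|00⟩⟨00| + |01⟩⟨01| + |10⟩⟨10|)/3 + t(|01⟩⟨10| + |10⟩⟨01|)`. -/
def coherentPerturbation (t : ℝ) : Matrix (Fin 2 × Fin 2) (Fin 2 × Fin 2) ℂ :=
  (1 / 3 : ℂ) • proj (vecKron (ket2 0) (ket2 0)) +
    ((1 / 3 - t : ℝ) : ℂ) •
      (proj (vecKron (ket2 0) (ket2 1)) + proj (vecKron (ket2 1) (ket2 0))) +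
    (t : ℂ) • proj (vecKron (ket2 0) (ket2 1) + vecKron (ket2 1) (ket2 0))

lemma isState_coherentPerturbation {t : ℝ} (h0 : 0 ≤ t) (h1 : t ≤ 1 / 3) :
    IsState (coherentPerturbation t) := by
  refine ⟨?_, ?_⟩
  · refine (((posSemidef_proj _).smul ?_).add
      (((posSemidef_proj _).add (posSemidef_proj _)).smul ?_)).add ((posSemidef_proj _).smul ?_)
    · positivity
    · exact Complex.zero_le_real.mpr (by linarith)
    · exact Complex.zero_le_real.mpr h0
  · simp [coherentPerturbation, Matrix.trace, Fintype.sum_prod_type, proj, vecMulVec_apply,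
      vecKron, ket2]
    ring

lemma entangledState_coherentPerturbation {t : ℝ} (h0 : 0 < t) (h1 : t ≤ 1 / 3) :
    EntangledState (coherentPerturbation t) := by
  refine ⟨isState_coherentPerturbation h0.le h1, fun hs => h0.ne' ?_⟩
  have h := hs.coherence_eq_zero
    (by simp [coherentPerturbation, proj, vecMulVec_apply, vecKron, ket2])
  simpa [coherentPerturbation, proj, vecMulVec_apply, vecKron, ket2] using h

/-- `ρ = (1/3)(|00⟩⟨00| + |01⟩⟨01| + |10⟩⟨10|)` is separable and has
entangled states arbitrarily close to it. -/
theorem stmt_1 (ρ : Matrix (Fin 2 × Fin 2) (Fin 2 × Fin 2) ℂ)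
    (hρ : ρ = (1/3 : ℂ) • (proj (vecKron (ket2 0) (ket2 0)) +
        proj (vecKron (ket2 0) (ket2 1)) + proj (vecKron (ket2 1) (ket2 0)))) :
    SeparableState ρ ∧
      ∀ ε : ℝ, 0 < ε → ∃ σ, EntangledState σ ∧ traceDist ρ σ ≤ ε := by
  subst hρ
  refine ⟨⟨3, fun _ => 1 / 3, fun k => proj (ket2 (![0, 0, 1] k)),
    fun k => proj (ket2 (![0, 1, 0] k)), fun _ => by norm_num, by norm_num,
    fun _ => isState_proj_ket2 _, fun _ => isState_proj_ket2 _, ?_⟩, fun ε hε => ?_⟩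
  · simp [Fin.sum_univ_three, proj_vecKron, smul_add]
  · have ht : 0 < min (1 / 3) (ε / 2) := by positivity
    set t := min (1 / 3) (ε / 2) with ht_def
    refine ⟨coherentPerturbation t,
      entangledState_coherentPerturbation ht (min_le_left _ _), ?_⟩
    refine (traceDist_le_of_row_sum_le ht.le ?_).trans ?_
    · rintro ⟨i, j⟩
      fin_cases i <;> fin_cases j <;>
        simp [Fintype.sum_prod_type, coherentPerturbation, proj, vecMulVec_apply, vecKron,
          ket2, abs_of_pos ht, ht.le]
    · have : t ≤ ε / 2 := min_le_right _ _
      simp only [Fintype.card_prod, Fintype.card_fin]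
      push_cast
      linarith
end
end

section
/- Let ρ = (1/2)(|01⟩⟨01| + |10⟩⟨10|) on ℂ² ⊗ ℂ². For every ε with 0 < ε ≤ 1, the state ρ_ε = (1−ε)ρ + ε|ψ₊⟩⟨ψ₊| is entangled and satisfies δ(ρ, ρ_ε) ≤ ε; consequently there are entangled states arbitrarily close to ρ. -/
open Matrix Kronecker BigOperators
open scoped ComplexOrder

noncomputable section

theorem Matrix.PosSemidef.apply_eq_zero_of_diag_eq_zero {n : Type*} [Fintype n]
    {M : Matrix n n ℂ} (hM : M.PosSemidef) {i : n} (hi : M i i = 0) (j : n) : M i j = 0 := by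
  have h := (hM.submatrix ![i, j]).det_nonneg
  have hji : M j i = star (M i j) := (hM.isHermitian.apply j i).symm
  rw [det_fin_two] at h
  simp only [submatrix_apply, cons_val_zero, cons_val_one, hi, zero_mul, zero_sub, hji] at h
  have h2 : 0 ≤ M i j * star (M i j) := mul_star_self_nonneg _
  have h3 : M i j * star (M i j) = 0 := le_antisymm (neg_nonneg.mp h) h2
  simpa using h3

/-- The Peres criterion: separable states have a positive partial transpose. -/
theorem SeparableState.posSemidef_PT {dA dB : ℕ}
    {σ : Matrix (Fin dA × Fin dB) (Fin dA × Fin dB) ℂ} (h : SeparableState σ) :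
    (PT σ).PosSemidef := by
  obtain ⟨m, p, A, B, hp, -, hA, hB, rfl⟩ := h
  have hPT : PT (∑ k, ((p k : ℂ) • (A k ⊗ₖ B k))) = ∑ k, ((p k : ℂ) • ((A k)ᵀ ⊗ₖ B k)) := by
    ext x y
    simp [PT, Matrix.sum_apply, kroneckerMap_apply]
  rw [hPT]
  refine posSemidef_sum _ fun k _ => ?_
  exact ((hA k).1.transpose.kronecker (hB k).1).smul (by exact_mod_cast hp k)

theorem Matrix.IsHermitian.sum_dotProduct_eigenvectorBasis {n : Type*} [Fintype n]
    [DecidableEq n] {D : Matrix n n ℂ} (hD : D.IsHermitian) (P : Matrix n n ℂ) :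
    ∑ i, star (⇑(hD.eigenvectorBasis i)) ⬝ᵥ (P *ᵥ ⇑(hD.eigenvectorBasis i)) = P.trace := by
  have h : (star (hD.eigenvectorUnitary : Matrix n n ℂ) * P *
      (hD.eigenvectorUnitary : Matrix n n ℂ)).trace = P.trace := by
    rw [trace_mul_comm, ← mul_assoc, Unitary.mul_star_self_of_mem hD.eigenvectorUnitary.2,
      one_mul]
  rw [← h, mul_assoc]
  rfl

theorem traceDist_le_of_sub_eq {n : Type*} [Fintype n] [DecidableEq n]
    {ρ τ P Q : Matrix n n ℂ} (hP : P.PosSemidef) (hQ : Q.PosSemidef) (h : ρ - τ = P - Q) :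
    traceDist ρ τ ≤ (P.trace.re + Q.trace.re) / 2 := by
  have hD : (ρ - τ).IsHermitian := h ▸ hP.isHermitian.sub hQ.isHermitian
  rw [traceDist, dif_pos hD, ← hD.sum_dotProduct_eigenvectorBasis P,
    ← hD.sum_dotProduct_eigenvectorBasis Q, Complex.re_sum, Complex.re_sum,
    ← Finset.sum_add_distrib, one_div, inv_mul_eq_div]
  gcongr with i
  have hp := (Complex.le_def.mp (hP.dotProduct_mulVec_nonneg (hD.eigenvectorBasis i))).1
  have hq := (Complex.le_def.mp (hQ.dotProduct_mulVec_nonneg (hD.eigenvectorBasis i))).1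
  have he : hD.eigenvalues i =
      (star (⇑(hD.eigenvectorBasis i)) ⬝ᵥ (P *ᵥ ⇑(hD.eigenvectorBasis i))).re -
      (star (⇑(hD.eigenvectorBasis i)) ⬝ᵥ (Q *ᵥ ⇑(hD.eigenvectorBasis i))).re := by
    rw [← Complex.sub_re, ← dotProduct_sub, ← sub_mulVec, ← h]
    exact hD.eigenvalues_eq i
  rw [Complex.zero_re] at hp hq
  rw [he, abs_le]
  constructor <;> linarith

/-- Mixing a state with weight `ε` of another one moves it by at most `ε`. -/
theorem traceDist_mix_le {n : Type*} [Fintype n] [DecidableEq n] {ρ τ : Matrix n n ℂ}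
    (hρ : IsState ρ) (hτ : IsState τ) {ε : ℝ} (hε : 0 ≤ ε) :
    traceDist ρ ((1 - (ε : ℂ)) • ρ + (ε : ℂ) • τ) ≤ ε := by
  have hε' : (0 : ℂ) ≤ ε := by exact_mod_cast hε
  refine (traceDist_le_of_sub_eq (hρ.1.smul hε') (hτ.1.smul hε') (by module)).trans_eq ?_
  simp [trace_smul, hρ.2, hτ.2]

theorem IsState.mix {n : Type*} [Fintype n] [DecidableEq n] {ρ τ : Matrix n n ℂ}
    (hρ : IsState ρ) (hτ : IsState τ) {ε : ℝ} (hε : 0 ≤ ε) (hε1 : ε ≤ 1) :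
    IsState ((1 - (ε : ℂ)) • ρ + (ε : ℂ) • τ) := by
  have h0 : (0 : ℂ) ≤ ε := by exact_mod_cast hε
  have h1 : (0 : ℂ) ≤ 1 - ε := by exact_mod_cast sub_nonneg.mpr hε1
  refine ⟨(hρ.1.smul h1).add (hτ.1.smul h0), ?_⟩
  simp [trace_add, trace_smul, hρ.2, hτ.2]

theorem isState_proj {n : Type*} [Fintype n] [DecidableEq n] {v : n → ℂ}
    (hv : v ⬝ᵥ star v = 1) : IsState (proj v) :=
  ⟨posSemidef_vecMulVec_self_star v, by rw [proj, trace_vecMulVec, hv]⟩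

theorem inv_sqrt_two_mul_self : (Real.sqrt 2 : ℂ)⁻¹ * (Real.sqrt 2 : ℂ)⁻¹ = 1 / 2 := by
  rw [← mul_inv, ← Complex.ofReal_mul, Real.mul_self_sqrt zero_le_two]
  norm_num

theorem isState_proj_psiPlus : IsState (proj psiPlus) := by
  apply isState_proj
  simp [psiPlus, dotProduct, Fintype.sum_prod_type, vecKron, ket2, inv_sqrt_two_mul_self]
  norm_num

/-- for `ρ = (1/2)(|01⟩⟨01| + |10⟩⟨10|)`, the states
`ρ_ε = (1−ε)ρ + ε|ψ₊⟩⟨ψ₊|` are entangled with `δ(ρ, ρ_ε) ≤ ε`; consequently there are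
entangled states arbitrarily close to `ρ`. -/
theorem stmt_2 (ρ : Matrix (Fin 2 × Fin 2) (Fin 2 × Fin 2) ℂ)
    (hρ : ρ = (1/2 : ℂ) •
      (proj (vecKron (ket2 0) (ket2 1)) + proj (vecKron (ket2 1) (ket2 0)))) :
    (∀ ε : ℝ, 0 < ε → ε ≤ 1 →
      EntangledState ((1 - (ε : ℂ)) • ρ + (ε : ℂ) • proj psiPlus) ∧
      traceDist ρ ((1 - (ε : ℂ)) • ρ + (ε : ℂ) • proj psiPlus) ≤ ε) ∧
    (∀ ε : ℝ, 0 < ε → ∃ σ, EntangledState σ ∧ traceDist ρ σ ≤ ε) := by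
  have hs : IsState ρ := by
    have h1 : IsState (proj (vecKron (ket2 0) (ket2 1))) := isState_proj (by
      simp [dotProduct, Fintype.sum_prod_type, vecKron, ket2])
    have h2 : IsState (proj (vecKron (ket2 1) (ket2 0))) := isState_proj (by
      simp [dotProduct, Fintype.sum_prod_type, vecKron, ket2])
    have h := h1.mix h2 (ε := 1 / 2) (by norm_num) (by norm_num)
    rw [hρ]
    convert h using 1
    push_cast
    module
  have main : ∀ ε : ℝ, 0 < ε → ε ≤ 1 →
      EntangledState ((1 - (ε : ℂ)) • ρ + (ε : ℂ) • proj psiPlus) ∧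
      traceDist ρ ((1 - (ε : ℂ)) • ρ + (ε : ℂ) • proj psiPlus) ≤ ε := by
    intro ε h0 h1
    refine ⟨⟨hs.mix isState_proj_psiPlus h0.le h1, fun hsep => ?_⟩,
      traceDist_mix_le hs isState_proj_psiPlus h0.le⟩
    have h := hsep.posSemidef_PT.apply_eq_zero_of_diag_eq_zero (i := (0, 0))
      (by simp [PT, hρ, proj, vecMulVec_apply, psiPlus, vecKron, ket2]) (1, 1)
    simp [PT, hρ, proj, vecMulVec_apply, psiPlus, vecKron, ket2, h0.ne'] at h
  refine ⟨main, fun ε hε => ?_⟩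
  obtain ⟨hent, hdist⟩ := main (min ε 1) (lt_min hε one_pos) (min_le_right _ _)
  exact ⟨_, hent, hdist.trans (min_le_left _ _)⟩
end
end

section
/- Let dA, dB ≥ 2, d = dA·dB, and let I denote the identity matrix on ℂ^{dA} ⊗ ℂ^{dB}. Every state ρ with Σ |λ_i| < 1/d, where λ_i are the eigenvalues of ρ − I/d, is separable; moreover ρ is not boundary separable: there exists ε > 0 such that every state σ with δ(ρ, σ) ≤ ε is separable. -/
open Matrix Kronecker BigOperators
open scoped ComplexOrder

noncomputable section

/-- The cone of unnormalised separable operators. -/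
def separableCone (m n : Type*) [Fintype m] [Fintype n] :
    AddSubmonoid (Matrix (m × n) (m × n) ℂ) :=
  AddSubmonoid.closure {M | ∃ (A : Matrix m m ℂ) (B : Matrix n n ℂ),
    A.PosSemidef ∧ B.PosSemidef ∧ M = A ⊗ₖ B}

section Cone

variable {m n : Type*} [Fintype m] [Fintype n]

lemma kronecker_mem_separableCone {A : Matrix m m ℂ} {B : Matrix n n ℂ}
    (hA : A.PosSemidef) (hB : B.PosSemidef) : A ⊗ₖ B ∈ separableCone m n :=
  AddSubmonoid.subset_closure ⟨A, B, hA, hB, rfl⟩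

lemma smul_mem_separableCone {c : ℂ} (hc : 0 ≤ c) {M : Matrix (m × n) (m × n) ℂ}
    (hM : M ∈ separableCone m n) : c • M ∈ separableCone m n := by
  induction hM using AddSubmonoid.closure_induction with
  | mem M h =>
    obtain ⟨A, B, hA, hB, rfl⟩ := h
    rw [← smul_kronecker]
    exact kronecker_mem_separableCone (hA.smul hc) hB
  | zero => simp
  | add M N _ _ hM hN => rw [smul_add]; exact add_mem hM hN

/-- Averaging the product vectors `(s e + z r f) ⊗ (x + ε (conj z) y)` over the fourth roots of unity
`z` leaves only the coherence between `e ⊗ x` and `f ⊗ y`. -/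
lemma phase_average_mem_separableCone (e f : m → ℂ) (x y : n → ℂ) (r s ε : ℝ) (hε : ε ^ 2 = 1) :
    (s ^ 2 : ℂ) • (proj e ⊗ₖ (proj x + proj y)) + (r ^ 2 : ℂ) • (proj f ⊗ₖ (proj x + proj y)) +
      (ε * (r * s) : ℂ) • (vecMulVec e (star f) ⊗ₖ vecMulVec x (star y) +
        vecMulVec f (star e) ⊗ₖ vecMulVec y (star x)) ∈ separableCone m n := by
  let g : ℂ → Matrix (m × n) (m × n) ℂ := fun z =>
    proj ((s : ℂ) • e + (z * r) • f) ⊗ₖ proj (x + ((ε : ℂ) * star z) • y)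
  have hg (z : ℂ) : g z ∈ separableCone m n :=
    kronecker_mem_separableCone (posSemidef_vecMulVec_self_star _)
      (posSemidef_vecMulVec_self_star _)
  have hε' : (ε : ℂ) ^ 2 = 1 := by exact_mod_cast hε
  have hI : Complex.I ^ 2 = -1 := Complex.I_sq
  have key := smul_mem_separableCone (c := 1 / 4) (by norm_num [Complex.le_def])
    (add_mem (add_mem (hg 1) (hg (-1))) (add_mem (hg Complex.I) (hg (-Complex.I))))
  convert key using 1
  ext ⟨a, j⟩ ⟨b, l⟩
  simp only [g, proj, vecMulVec, kroneckerMap_apply, Matrix.add_apply,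
    Matrix.smul_apply, of_apply, Pi.add_apply, Pi.smul_apply, Pi.star_apply, smul_eq_mul, star_add,
    star_mul', Complex.star_def, map_neg, map_one, Complex.conj_I, Complex.conj_ofReal, neg_neg]
  generalize starRingEnd ℂ (e b) = e', starRingEnd ℂ (f b) = f', starRingEnd ℂ (x l) = x',
    starRingEnd ℂ (y l) = y', e a = e, f a = f, x j = x, y j = y
  clear key hg
  linear_combination (s * r * ε * (e * f' - e' * f) * (x * y' - x' * y) / 2
    + s ^ 2 * e * e' * y * y' * ε ^ 2 / 2 + r ^ 2 * f * f' * x * x' / 2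
    - y * y' * r ^ 2 * f * f' * ε ^ 2 * (Complex.I ^ 2 - 1) / 2) * hI
    - (s ^ 2 * e * e' + r ^ 2 * f * f') * y * y' * hε'

variable [DecidableEq m]

/-- Schmidt decomposition of a unit vector. -/
lemma exists_schmidt {v : m × n → ℂ} (hv : star v ⬝ᵥ v = 1) :
    ∃ (e : m → m → ℂ) (u : m → n → ℂ) (r : m → ℝ), ∑ i, proj (e i) = 1 ∧
      (∀ i k, i ≠ k → star (u i) ⬝ᵥ u k = 0) ∧ (∀ i, u i = 0 ∨ star (u i) ⬝ᵥ u i = 1) ∧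
      ∑ i, r i ^ 2 = 1 ∧ ∀ p, v p = ∑ i, r i * (e i p.1 * u i p.2) := by
  let V : Matrix m n ℂ := of fun i j => v (i, j)
  have hP : (V * Vᴴ).PosSemidef := posSemidef_self_mul_conjTranspose V
  let U : Matrix m m ℂ := hP.isHermitian.eigenvectorUnitary
  have hU : U * Uᴴ = 1 := Unitary.coe_mul_star_self hP.isHermitian.eigenvectorUnitary
  have hU' : Uᴴ * U = 1 := Unitary.coe_star_mul_self hP.isHermitian.eigenvectorUnitary
  let q := hP.isHermitian.eigenvalues
  have hq (i : m) : 0 ≤ q i := hP.eigenvalues_nonneg i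
  let W := Uᴴ * V
  have hW : W * Wᴴ = diagonal fun i => (q i : ℂ) := by
    have h : V * Vᴴ = U * diagonal (fun i => (q i : ℂ)) * Uᴴ := hP.isHermitian.spectral_theorem
    calc W * Wᴴ = Uᴴ * (V * Vᴴ) * U := by
          simp only [W, conjTranspose_mul, conjTranspose_conjTranspose, Matrix.mul_assoc]
      _ = (Uᴴ * U) * diagonal (fun i => (q i : ℂ)) * (Uᴴ * U) := by
          rw [h]; simp only [Matrix.mul_assoc]
      _ = _ := by rw [hU']; simp
  have hWW (i k : m) : star (W i) ⬝ᵥ W k = if k = i then (q k : ℂ) else 0 := by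
    have := congr_fun₂ hW k i
    rw [diagonal_apply] at this
    rw [← this, dotProduct_comm]
    rfl
  have hr (i : m) : (Real.sqrt (q i) : ℂ) ^ 2 = q i := by
    exact_mod_cast Real.sq_sqrt (hq i)
  have hru (i : m) : (Real.sqrt (q i) : ℂ) • ((Real.sqrt (q i) : ℂ)⁻¹ • W i) = W i := by
    by_cases h : (Real.sqrt (q i) : ℂ) = 0
    · have : q i = 0 := (Real.sqrt_eq_zero (hq i)).1 (by exact_mod_cast h)
      have hz : star (W i) ⬝ᵥ W i = 0 := (hWW i i).trans (by simp [this])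
      have h0 : W i = 0 := dotProduct_star_self_eq_zero.1 hz
      simp [h0]
    · rw [smul_smul, mul_inv_cancel₀ h, one_smul]
  refine ⟨fun k i => U i k, fun i => (Real.sqrt (q i) : ℂ)⁻¹ • W i, fun i => Real.sqrt (q i),
    ?_, fun i k hik => ?_, fun i => ?_, ?_, fun p => ?_⟩
  · rw [← hU]
    ext a b
    simp [Matrix.sum_apply, proj, vecMulVec_apply, mul_apply]
  · simp [hWW, hik.symm]
  · by_cases h : (Real.sqrt (q i) : ℂ) = 0
    · simp [h]
    · right
      rw [star_smul, smul_dotProduct, dotProduct_smul, hWW, if_pos rfl, ← hr i]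
      simp only [smul_eq_mul, star_inv₀, Complex.star_def, Complex.conj_ofReal]
      field_simp
  · have htr : ((∑ i, q i : ℝ) : ℂ) = 1 := by
      rw [← hv]
      push_cast
      rw [← trace_diagonal, ← hW]
      have : (W * Wᴴ).trace = (V * Vᴴ).trace := by
        simp only [W, conjTranspose_mul, conjTranspose_conjTranspose]
        rw [trace_mul_comm, ← Matrix.mul_assoc, Matrix.mul_assoc _ U, hU, Matrix.mul_one,
          trace_mul_comm]
      rw [this]
      simp [trace, mul_apply, dotProduct, Fintype.sum_prod_type, V, mul_comm]
    simp only [Real.sq_sqrt (hq _)]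
    exact_mod_cast htr
  · have : V = U * W := by
      simp only [W]
      rw [← Matrix.mul_assoc, hU, Matrix.one_mul]
    have h := congr_fun₂ this p.1 p.2
    rw [mul_apply] at h
    refine h.trans (Finset.sum_congr rfl fun i _ => ?_)
    conv_lhs => rw [← hru i]
    simp only [Pi.smul_apply, smul_eq_mul]
    ring

variable [DecidableEq n]

/-- The complement of the span of orthogonal vectors of norm `0` or `1`. -/
lemma posSemidef_one_sub_sum_proj {κ : Type*} [Fintype κ] {u : κ → n → ℂ}
    (hu : ∀ i k, i ≠ k → star (u i) ⬝ᵥ u k = 0) (hu' : ∀ i, u i = 0 ∨ star (u i) ⬝ᵥ u i = 1) :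
    (1 - ∑ k, proj (u k)).PosSemidef := by
  have hG : (∑ k, proj (u k)) * ∑ k, proj (u k) = ∑ k, proj (u k) := by
    rw [Finset.sum_mul]
    refine Finset.sum_congr rfl fun i _ => ?_
    rw [Finset.mul_sum, Finset.sum_eq_single i]
    · rcases hu' i with h | h <;> simp [proj, vecMulVec_mul_vecMulVec, h]
    · intro k _ hk
      simp [proj, vecMulVec_mul_vecMulVec, hu i k hk.symm]
    · simp
  have hH : (∑ k, proj (u k))ᴴ = ∑ k, proj (u k) := by
    simp [proj, conjTranspose_sum, conjTranspose_vecMulVec]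
  have : 1 - ∑ k, proj (u k) = (1 - ∑ k, proj (u k))ᴴ * (1 - ∑ k, proj (u k)) := by
    rw [conjTranspose_sub, conjTranspose_one, hH, mul_sub, sub_mul, sub_mul, hG]
    simp
  rw [this]
  exact posSemidef_conjTranspose_mul_self _

/-- The scalar identity behind the entries of the separable decomposition of
`1 + ε • proj v`, for `v` in Schmidt form. -/
lemma sum_sum_schmidt {κ : Type*} [Fintype κ] {r : κ → ℂ} (hr : ∑ i, r i ^ 2 = 1)
    (e e' u u' : κ → ℂ) (ε : ℂ) :
    ∑ i, ∑ k, ((1 - r k ^ 2) * (e i * e' i * (u k * u' k)) + 1 / 2 *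
        (r k ^ 2 * (e i * e' i * (u i * u' i + u k * u' k)) +
          r i ^ 2 * (e k * e' k * (u i * u' i + u k * u' k)) +
          ε * (r i * r k) * (e i * e' k * (u i * u' k) + e k * e' i * (u k * u' i)))) =
      (∑ i, e i * e' i) * (∑ i, u i * u' i) + ∑ i, e i * e' i * (u i * u' i) +
        ε * ((∑ i, r i * (e i * u i)) * ∑ i, r i * (e' i * u' i)) := by
  let h : κ → κ → ℂ := fun i k =>
    r k ^ 2 * (e i * e' i * (u i * u' i + u k * u' k)) + ε * (r i * r k) * (e i * e' k * (u i * u' k))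
  have hcomm : ∑ i, ∑ k, h k i = ∑ i, ∑ k, h i k := Finset.sum_comm
  calc _ = ∑ i, ∑ k, (1 - r k ^ 2) * (e i * e' i * (u k * u' k)) +
        1 / 2 * (∑ i, ∑ k, h i k + ∑ i, ∑ k, h k i) := by
        simp only [← Finset.sum_add_distrib, Finset.mul_sum]
        refine Finset.sum_congr rfl fun i _ => Finset.sum_congr rfl fun k _ => ?_
        simp only [h]
        ring
    _ = ∑ i, ∑ k, ((e i * e' i) * (u k * u' k) + r k ^ 2 * (e i * e' i * (u i * u' i)) +
          ε * ((r i * (e i * u i)) * (r k * (e' k * u' k)))) := by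
        rw [hcomm, ← two_mul, ← mul_assoc, one_div_mul_cancel two_ne_zero, one_mul]
        simp only [← Finset.sum_add_distrib]
        refine Finset.sum_congr rfl fun i _ => Finset.sum_congr rfl fun k _ => ?_
        simp only [h]
        ring
    _ = _ := by
        simp only [Finset.sum_add_distrib, ← Finset.sum_mul, ← Finset.mul_sum, hr, one_mul]

lemma one_add_smul_proj_mem_separableCone_of_schmidt {e : m → m → ℂ} {u : m → n → ℂ} {r : m → ℝ}
    (he : ∑ i, proj (e i) = 1) (hu : ∀ i k, i ≠ k → star (u i) ⬝ᵥ u k = 0)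
    (hu' : ∀ i, u i = 0 ∨ star (u i) ⬝ᵥ u i = 1) (hr : ∑ i, r i ^ 2 = 1)
    {ε : ℝ} (hε : ε ^ 2 = 1) {v : m × n → ℂ} (hv : ∀ p, v p = ∑ i, r i * (e i p.1 * u i p.2)) :
    1 + (ε : ℂ) • proj v ∈ separableCone m n := by
  have hr1 (k : m) : r k ^ 2 ≤ 1 :=
    hr ▸ Finset.single_le_sum (fun i _ => sq_nonneg (r i)) (Finset.mem_univ k)
  have he' (i : m) : (proj (e i)).PosSemidef := posSemidef_vecMulVec_self_star _
  have hu'' (i : m) : (proj (u i)).PosSemidef := posSemidef_vecMulVec_self_star _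
  let R : m → m → Matrix (m × n) (m × n) ℂ := fun i k =>
    ((1 - r k ^ 2 : ℝ) : ℂ) • (proj (e i) ⊗ₖ proj (u k)) + (1 / 2 : ℂ) •
      ((r k ^ 2 : ℂ) • (proj (e i) ⊗ₖ (proj (u i) + proj (u k))) +
        (r i ^ 2 : ℂ) • (proj (e k) ⊗ₖ (proj (u i) + proj (u k))) +
        (ε * (r i * r k) : ℂ) • (vecMulVec (e i) (star (e k)) ⊗ₖ vecMulVec (u i) (star (u k)) +
        vecMulVec (e k) (star (e i)) ⊗ₖ vecMulVec (u k) (star (u i))))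
  have hR (i k : m) : R i k ∈ separableCone m n :=
    add_mem (smul_mem_separableCone (by exact_mod_cast sub_nonneg.2 (hr1 k))
      (kronecker_mem_separableCone (he' _) (hu'' _)))
      (smul_mem_separableCone (by norm_num [Complex.le_def])
        (phase_average_mem_separableCone _ _ _ _ _ _ _ hε))
  let D : m → Matrix (m × n) (m × n) ℂ := fun i =>
    (((1 + ε) * r i ^ 2 : ℝ) : ℂ) • (proj (e i) ⊗ₖ proj (u i))
  have hD (i : m) : D i ∈ separableCone m n := by
    refine smul_mem_separableCone ?_ (kronecker_mem_separableCone (he' _) (hu'' _))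
    have : 0 ≤ (1 + ε) * r i ^ 2 := mul_nonneg (by nlinarith) (sq_nonneg _)
    exact_mod_cast this
  have key : 1 + (ε : ℂ) • proj v =
      (1 : Matrix m m ℂ) ⊗ₖ (1 - ∑ k, proj (u k)) + ∑ i, ∑ k, if i = k then D i else R i k := by
    have hite (i k : m) : (if i = k then D i else R i k) =
        R i k - if i = k then R i i - D i else 0 := by
      split_ifs with h
      · subst h; simp
      · simp
    have hrc : ∑ i, (r i : ℂ) ^ 2 = 1 := by exact_mod_cast hr
    simp only [hite, Finset.sum_sub_distrib, Finset.sum_ite_eq, Finset.mem_univ, if_true]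
    rw [← one_kronecker_one, ← he]
    ext ⟨a, j⟩ ⟨b, l⟩
    simp only [R, D, proj, vecMulVec, kroneckerMap_apply, Matrix.add_apply, Matrix.sub_apply,
      Matrix.sum_apply, Matrix.smul_apply, of_apply, Pi.star_apply, smul_eq_mul, hv, star_sum,
      star_mul', Complex.star_def, Complex.conj_ofReal]
    push_cast
    have hsum := sum_sum_schmidt hrc (fun i => e i a) (fun i => starRingEnd ℂ (e i b))
      (fun i => u i j) (fun i => starRingEnd ℂ (u i l)) ε
    have hdiag : ∑ i, e i a * starRingEnd ℂ (e i b) * (u i j * starRingEnd ℂ (u i l)) =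
        ∑ i, ((1 - (r i : ℂ) ^ 2) * (e i a * starRingEnd ℂ (e i b) *
          (u i j * starRingEnd ℂ (u i l))) + 1 / 2 *
            ((r i : ℂ) ^ 2 * (e i a * starRingEnd ℂ (e i b) *
              (u i j * starRingEnd ℂ (u i l) + u i j * starRingEnd ℂ (u i l))) +
            (r i : ℂ) ^ 2 * (e i a * starRingEnd ℂ (e i b) *
              (u i j * starRingEnd ℂ (u i l) + u i j * starRingEnd ℂ (u i l))) +
            ε * (r i * r i) * (e i a * starRingEnd ℂ (e i b) * (u i j * starRingEnd ℂ (u i l)) +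
              e i a * starRingEnd ℂ (e i b) * (u i j * starRingEnd ℂ (u i l))))) -
        ∑ i, (1 + ε) * (r i : ℂ) ^ 2 *
          (e i a * starRingEnd ℂ (e i b) * (u i j * starRingEnd ℂ (u i l))) := by
      rw [← Finset.sum_sub_distrib]
      exact Finset.sum_congr rfl fun i _ => by ring
    rw [← hdiag, hsum]
    ring
  rw [key]
  refine add_mem (kronecker_mem_separableCone PosSemidef.one (posSemidef_one_sub_sum_proj hu hu'))
    (sum_mem fun i _ => sum_mem fun k _ => ?_)
  split_ifs
  exacts [hD i, hR i k]

lemma one_add_smul_proj_mem_separableCone {ε : ℝ} (hε : ε ^ 2 = 1) {v : m × n → ℂ}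
    (hv : star v ⬝ᵥ v = 1) : 1 + (ε : ℂ) • proj v ∈ separableCone m n := by
  obtain ⟨e, u, r, he, hu, hu', hr, hv⟩ := exists_schmidt hv
  exact one_add_smul_proj_mem_separableCone_of_schmidt he hu hu' hr hε hv

lemma eq_sum_eigenvalues_smul_proj {H : Matrix n n ℂ} (hH : H.IsHermitian) :
    H = ∑ i, (hH.eigenvalues i : ℂ) • proj (hH.eigenvectorBasis i : n → ℂ) := by
  conv_lhs => rw [hH.spectral_theorem]
  ext a b
  simp [Matrix.sum_apply, proj, vecMulVec_apply, mul_apply, Unitary.conjStarAlgAut_apply,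
    diagonal_apply, IsHermitian.eigenvectorUnitary_apply, mul_comm]
  exact Finset.sum_congr rfl fun i _ => mul_assoc _ _ _

lemma sum_abs_eigenvalues_smul_one_add_mem_separableCone {H : Matrix (m × n) (m × n) ℂ}
    (hH : H.IsHermitian) {ε : ℝ} (hε : ε ^ 2 = 1) :
    ((∑ i, |hH.eigenvalues i| : ℝ) : ℂ) • (1 : Matrix (m × n) (m × n) ℂ) + (ε : ℂ) • H ∈
      separableCone m n := by
  let s : m × n → ℝ := fun i => if 0 ≤ hH.eigenvalues i then ε else -ε
  have hs (i) : s i ^ 2 = 1 := by simp only [s]; split_ifs <;> simp only [neg_sq, hε]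
  have hs' (i) : |hH.eigenvalues i| * s i = ε * hH.eigenvalues i := by
    simp only [s]
    split_ifs with h
    · rw [abs_of_nonneg h, mul_comm]
    · rw [abs_of_neg (not_le.1 h), neg_mul_neg, mul_comm]
  have hv (i) : star (hH.eigenvectorBasis i : m × n → ℂ) ⬝ᵥ (hH.eigenvectorBasis i) = 1 := by
    rw [dotProduct_comm]
    have := hH.eigenvectorBasis.inner_eq_one i
    rwa [EuclideanSpace.inner_eq_star_dotProduct] at this
  have key : ((∑ i, |hH.eigenvalues i| : ℝ) : ℂ) • (1 : Matrix (m × n) (m × n) ℂ) + (ε : ℂ) • H =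
      ∑ i, ((|hH.eigenvalues i| : ℝ) : ℂ) •
        (1 + (s i : ℂ) • proj (hH.eigenvectorBasis i : m × n → ℂ)) := by
    simp only [smul_add, smul_smul, Finset.sum_add_distrib, ← Complex.ofReal_mul, hs',
      ← Finset.sum_smul, ← Complex.ofReal_sum]
    rw [add_right_inj]
    simp only [Complex.ofReal_mul, ← smul_smul, ← Finset.smul_sum]
    rw [← eq_sum_eigenvalues_smul_proj hH]
  rw [key]
  exact sum_mem fun i _ => smul_mem_separableCone (by exact_mod_cast abs_nonneg _)
    (one_add_smul_proj_mem_separableCone (hs i) (hv i))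

lemma PosSemidef.exists_smul_isState {A : Matrix n n ℂ} (hA : A.PosSemidef) (h0 : A ≠ 0) :
    ∃ (c : ℝ) (A' : Matrix n n ℂ), 0 ≤ c ∧ IsState A' ∧ A = (c : ℂ) • A' := by
  obtain ⟨c, hc, hc'⟩ := RCLike.nonneg_iff_exists_ofReal.1 hA.trace_nonneg
  replace hc' : (c : ℂ) = A.trace := hc'
  have hne : (c : ℂ) ≠ 0 := fun h => h0 (hA.trace_eq_zero_iff.1 (hc'.symm.trans h))
  refine ⟨c, (c : ℂ)⁻¹ • A, hc, ⟨hA.smul ?_, ?_⟩, ?_⟩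
  · rw [← Complex.ofReal_inv]
    exact_mod_cast inv_nonneg.2 hc
  · rw [trace_smul, ← hc', smul_eq_mul, inv_mul_cancel₀ hne]
  · rw [smul_smul, mul_inv_cancel₀ hne, one_smul]

lemma exists_sum_of_mem_separableCone {M : Matrix (m × n) (m × n) ℂ}
    (hM : M ∈ separableCone m n) :
    ∃ (ι : Type) (_ : Fintype ι) (p : ι → ℝ) (A : ι → Matrix m m ℂ) (B : ι → Matrix n n ℂ),
      (∀ k, 0 ≤ p k) ∧ (∀ k, IsState (A k)) ∧ (∀ k, IsState (B k)) ∧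
      M = ∑ k, (p k : ℂ) • (A k ⊗ₖ B k) := by
  induction hM using AddSubmonoid.closure_induction with
  | mem M h =>
    obtain ⟨A, B, hA, hB, rfl⟩ := h
    by_cases hA0 : A = 0
    · exact ⟨Empty, inferInstance, nofun, nofun, nofun, nofun, nofun, nofun, by simp [hA0]⟩
    by_cases hB0 : B = 0
    · exact ⟨Empty, inferInstance, nofun, nofun, nofun, nofun, nofun, nofun, by simp [hB0]⟩
    obtain ⟨c, A', hc, hA', rfl⟩ := PosSemidef.exists_smul_isState hA hA0
    obtain ⟨d, B', hd, hB', rfl⟩ := PosSemidef.exists_smul_isState hB hB0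
    exact ⟨Unit, inferInstance, fun _ => c * d, fun _ => A', fun _ => B',
      fun _ => mul_nonneg hc hd, fun _ => hA', fun _ => hB',
      by simp [smul_kronecker, kronecker_smul, smul_smul, mul_comm, -Complex.coe_smul]⟩
  | zero => exact ⟨Empty, inferInstance, nofun, nofun, nofun, nofun, nofun, nofun, by simp⟩
  | add M N _ _ hM hN =>
    obtain ⟨ι, _, p, A, B, hp, hA, hB, rfl⟩ := hM
    obtain ⟨κ, _, q, C, D, hq, hC, hD, rfl⟩ := hN
    refine ⟨ι ⊕ κ, inferInstance, Sum.elim p q, Sum.elim A C, Sum.elim B D, ?_, ?_, ?_, ?_⟩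
    · rintro (k | k) <;> simp [hp, hq]
    · rintro (k | k) <;> simp [hA, hC]
    · rintro (k | k) <;> simp [hB, hD]
    · simp

end Cone

lemma SeparableState.of_mem_separableCone {dA dB : ℕ}
    {ρ : Matrix (Fin dA × Fin dB) (Fin dA × Fin dB) ℂ} (hρ : ρ.trace = 1)
    (h : ρ ∈ separableCone (Fin dA) (Fin dB)) : SeparableState ρ := by
  obtain ⟨ι, _, p, A, B, hp, hA, hB, rfl⟩ := exists_sum_of_mem_separableCone h
  let f := (Fintype.equivFin ι).symm
  refine ⟨Fintype.card ι, p ∘ f, A ∘ f, B ∘ f, fun k => hp _, ?_, fun k => hA _, fun k => hB _, ?_⟩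
  · simp only [trace_sum, trace_smul, trace_kronecker, (hA _).2, (hB _).2, smul_eq_mul,
      mul_one] at hρ
    simp only [Function.comp_apply, f.sum_comp p]
    exact_mod_cast hρ
  · exact (f.sum_comp fun k => (p k : ℂ) • (A k ⊗ₖ B k)).symm

lemma two_mul_traceDist {n : Type*} [Fintype n] [DecidableEq n] {ρ τ : Matrix n n ℂ}
    (h : (ρ - τ).IsHermitian) : 2 * traceDist ρ τ = ∑ i, |h.eigenvalues i| := by
  rw [traceDist, dif_pos h]
  ring

/-- every state in the ball `Tr|ρ − I/d| < 1/d` around the maximally mixed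
state (`d = dA·dB`) is separable and is not boundary separable. -/
theorem stmt_8 (dA dB : ℕ) (hA : 2 ≤ dA) (hB : 2 ≤ dB)
    (ρ : Matrix (Fin dA × Fin dB) (Fin dA × Fin dB) ℂ) (hρ : IsState ρ)
    (hball : 2 * traceDist ρ ((((dA * dB : ℕ) : ℂ))⁻¹ •
        (1 : Matrix (Fin dA × Fin dB) (Fin dA × Fin dB) ℂ)) < 1 / ((dA * dB : ℕ) : ℝ)) :
    SeparableState ρ ∧
    ∃ ε : ℝ, 0 < ε ∧ ∀ σ, IsState σ → traceDist ρ σ ≤ ε → SeparableState σ := by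
  set c : ℝ := 1 / ((dA * dB : ℕ) : ℝ) with hc
  have hcc : (((dA * dB : ℕ) : ℂ))⁻¹ = (c : ℂ) := by simp [hc]
  rw [hcc] at hball
  have hτ : ((c : ℂ) • (1 : Matrix (Fin dA × Fin dB) (Fin dA × Fin dB) ℂ)).IsHermitian := by
    simp [IsHermitian, conjTranspose_smul]
  have hH := hρ.1.isHermitian.sub hτ
  have h1 := sum_abs_eigenvalues_smul_one_add_mem_separableCone hH (ε := 1) (by norm_num)
  rw [← two_mul_traceDist hH] at h1
  have hone : (1 : Matrix (Fin dA × Fin dB) (Fin dA × Fin dB) ℂ) ∈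
      separableCone (Fin dA) (Fin dB) := by
    rw [← one_kronecker_one]
    exact kronecker_mem_separableCone PosSemidef.one PosSemidef.one
  refine ⟨SeparableState.of_mem_separableCone hρ.2 ?_,
    (c - 2 * traceDist ρ ((c : ℂ) • 1)) / 2, by linarith, fun σ hσ hσρ => ?_⟩
  · have h2 := smul_mem_separableCone (c := ((c - 2 * traceDist ρ ((c : ℂ) • 1) : ℝ) : ℂ))
      (by exact_mod_cast (sub_pos.2 hball).le) hone
    convert add_mem h1 h2 using 1
    push_cast
    module
  · have hK := hρ.1.isHermitian.sub hσ.1.isHermitian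
    have h3 := sum_abs_eigenvalues_smul_one_add_mem_separableCone hK (ε := -1) (by norm_num)
    rw [← two_mul_traceDist hK] at h3
    have h2 := smul_mem_separableCone
      (c := ((c - 2 * traceDist ρ ((c : ℂ) • 1) - 2 * traceDist ρ σ : ℝ) : ℂ))
      (by
        have : 0 ≤ c - 2 * traceDist ρ ((c : ℂ) • 1) - 2 * traceDist ρ σ := by linarith
        exact_mod_cast this) hone
    refine SeparableState.of_mem_separableCone hσ.2 ?_
    convert add_mem (add_mem h1 h2) h3 using 1
    push_cast
    module
end
end

section
/- Let d = dA·dB, let I be the identity matrix on ℂ^{dA} ⊗ ℂ^{dB}, let ρ be a state, and let 0 < t ≤ 1. Then the state (1−t)(I/d) + tρ is classical with respect to A if and only if ρ is classical with respect to A; equivalently, (1−t)(I/d) + tρ is discordant if and only if ρ is discordant. -/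
open Matrix Kronecker BigOperators
open scoped ComplexOrder

noncomputable section

/-- The isometry `w ↦ v ⊗ w` from `ℂ^dB` to `ℂ^dA ⊗ ℂ^dB`. -/
def tensorLeft {dA : ℕ} (dB : ℕ) (v : Fin dA → ℂ) : Matrix (Fin dA × Fin dB) (Fin dB) ℂ :=
  Matrix.of fun p b => v p.1 * (1 : Matrix (Fin dB) (Fin dB) ℂ) p.2 b

theorem tensorLeft_compress_proj_kronecker {dA dB : ℕ} (v w : Fin dA → ℂ)
    (M : Matrix (Fin dB) (Fin dB) ℂ) :
    (tensorLeft dB v)ᴴ * (proj w ⊗ₖ M) * tensorLeft dB v =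
      ((star v ⬝ᵥ w) * (star w ⬝ᵥ v)) • M := by
  ext b c
  simp only [tensorLeft, proj, Matrix.mul_apply, Matrix.conjTranspose_apply, Matrix.of_apply,
    Matrix.one_apply, Fintype.sum_prod_type, kroneckerMap_apply, vecMulVec_apply, mul_ite,
    mul_one, mul_zero, ite_mul, zero_mul, apply_ite star, star_zero, Finset.sum_ite_eq',
    Finset.mem_univ, if_true, Matrix.smul_apply, smul_eq_mul, dotProduct, Pi.star_apply]
  rw [Finset.sum_mul_sum]
  simp_rw [Finset.sum_mul]
  rw [Finset.sum_comm]
  refine Finset.sum_congr rfl fun i _ => Finset.sum_congr rfl fun j _ => ?_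
  ring

theorem IsONBasis.sum_proj {d : ℕ} {v : Fin d → Fin d → ℂ} (hv : IsONBasis v) :
    ∑ i, proj (v i) = 1 := by
  have h : (Matrix.of v)ᵀᴴ * (Matrix.of v)ᵀ = 1 := by
    ext i j
    simpa [Matrix.mul_apply, dotProduct, Matrix.one_apply] using hv i j
  rw [← mul_eq_one_comm.mp h]
  ext a b
  simp [Matrix.sum_apply, proj, vecMulVec_apply, Matrix.mul_apply]

theorem Matrix.PosSemidef.exists_isState {d : ℕ} (hd : 0 < d) {M : Matrix (Fin d) (Fin d) ℂ}
    (hM : M.PosSemidef) : ∃ (l : ℝ) (τ : Matrix (Fin d) (Fin d) ℂ),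
      0 ≤ l ∧ IsState τ ∧ M = (l : ℂ) • τ := by
  obtain ⟨l, hl, hlM⟩ := RCLike.nonneg_iff_exists_ofReal.mp hM.trace_nonneg
  replace hlM : (l : ℂ) = M.trace := hlM
  rcases hl.eq_or_lt with h0 | hpos
  · have hM0 : M = 0 := hM.trace_eq_zero_iff.mp (by rw [← hlM, ← h0]; simp)
    have hd' : (d : ℂ) ≠ 0 := by exact_mod_cast hd.ne'
    refine ⟨0, (d : ℂ)⁻¹ • 1, le_rfl, ⟨PosSemidef.one.smul ?_, ?_⟩, by simp [hM0]⟩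
    · exact inv_nonneg.mpr (Nat.cast_nonneg d)
    · simp [Matrix.trace_smul, hd']
  · have hl' : (l : ℂ) ≠ 0 := by exact_mod_cast hpos.ne'
    refine ⟨l, (l : ℂ)⁻¹ • M, hl, ⟨hM.smul ?_, ?_⟩, ?_⟩
    · exact inv_nonneg.mpr (by exact_mod_cast hl)
    · rw [Matrix.trace_smul, ← hlM, smul_eq_mul, inv_mul_cancel₀ hl']
    · rw [smul_smul, mul_inv_cancel₀ hl', one_smul]

theorem IsONBasis.classicalA_sum {dA dB : ℕ} (hB : 0 < dB) {v : Fin dA → Fin dA → ℂ}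
    (hv : IsONBasis v) {M : Fin dA → Matrix (Fin dB) (Fin dB) ℂ}
    (hM : ∀ i, (M i).PosSemidef) : ClassicalA (∑ i, proj (v i) ⊗ₖ M i) := by
  choose l τ hl hτ h using fun i => (hM i).exists_isState hB
  refine ⟨v, hv, l, τ, hl, hτ, Finset.sum_congr rfl fun i _ => ?_⟩
  rw [h i, kronecker_smul]

theorem IsONBasis.posSemidef_of_sum {dA dB : ℕ} {v : Fin dA → Fin dA → ℂ}
    (hv : IsONBasis v) {M : Fin dA → Matrix (Fin dB) (Fin dB) ℂ}
    (h : (∑ i, proj (v i) ⊗ₖ M i).PosSemidef) (i : Fin dA) : (M i).PosSemidef := by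
  have key := h.conjTranspose_mul_mul_same (tensorLeft dB (v i))
  rw [Matrix.mul_sum, Matrix.sum_mul] at key
  simp_rw [tensorLeft_compress_proj_kronecker, hv _ _] at key
  simpa using key

theorem IsONBasis.sum_proj_kronecker_smul_one_add {dA dB : ℕ} {v : Fin dA → Fin dA → ℂ}
    (hv : IsONBasis v) (c s : ℂ) (M : Fin dA → Matrix (Fin dB) (Fin dB) ℂ) :
    ∑ i, proj (v i) ⊗ₖ (c • 1 + s • M i) = c • 1 + s • ∑ i, proj (v i) ⊗ₖ M i := by
  have h : ∑ i, proj (v i) ⊗ₖ (1 : Matrix (Fin dB) (Fin dB) ℂ) = 1 := by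
    rw [← one_kronecker_one, ← hv.sum_proj]
    ext a b
    simp [Matrix.sum_apply, Finset.sum_mul]
  simp_rw [kronecker_add, kronecker_smul, Finset.sum_add_distrib, ← Finset.smul_sum, h]

/-- for `0 < t ≤ 1`, the state `(1−t)(I/d) + tρ` (`d = dA·dB`) is
classical with respect to `A` iff `ρ` is; equivalently it is discordant iff `ρ` is. -/
theorem stmt_13 (dA dB : ℕ)
    (ρ : Matrix (Fin dA × Fin dB) (Fin dA × Fin dB) ℂ) (hρ : IsState ρ)
    (t : ℝ) (ht0 : 0 < t) (ht1 : t ≤ 1) :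
    (ClassicalA ((1 - (t : ℂ)) • ((((dA * dB : ℕ) : ℂ))⁻¹ •
        (1 : Matrix (Fin dA × Fin dB) (Fin dA × Fin dB) ℂ)) + (t : ℂ) • ρ) ↔
      ClassicalA ρ) ∧
    (¬ ClassicalA ((1 - (t : ℂ)) • ((((dA * dB : ℕ) : ℂ))⁻¹ •
        (1 : Matrix (Fin dA × Fin dB) (Fin dA × Fin dB) ℂ)) + (t : ℂ) • ρ) ↔
      ¬ ClassicalA ρ) := by
  have hd : 0 < dA * dB := by
    rcases Nat.eq_zero_or_pos (dA * dB) with h | h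
    · have : IsEmpty (Fin dA × Fin dB) := Fintype.card_eq_zero_iff.mp (by simpa using h)
      exact absurd hρ.2 (by simp [Matrix.trace])
    · exact h
  have hB : 0 < dB := Nat.pos_of_mul_pos_left hd
  have htc : (t : ℂ) ≠ 0 := by exact_mod_cast ht0.ne'
  have htn : (0 : ℂ) ≤ t := by exact_mod_cast ht0.le
  have hc : 0 ≤ (1 - (t : ℂ)) * ((dA * dB : ℕ) : ℂ)⁻¹ :=
    mul_nonneg (by exact_mod_cast sub_nonneg.mpr ht1) (inv_nonneg.mpr (Nat.cast_nonneg _))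
  rw [smul_smul]
  generalize (1 - (t : ℂ)) * ((dA * dB : ℕ) : ℂ)⁻¹ = c at hc
  refine (fun h => ⟨h, not_congr h⟩) ⟨?_, ?_⟩
  · rintro ⟨v, hv, l, τ, -, -, h⟩
    simp_rw [← kronecker_smul] at h
    have hρs : ρ = ∑ i, proj (v i) ⊗ₖ ((-(t : ℂ)⁻¹ * c) • 1 + (t : ℂ)⁻¹ • ((l i : ℂ) • τ i)) := by
      rw [hv.sum_proj_kronecker_smul_one_add, ← h, smul_add, smul_smul, smul_smul,
        inv_mul_cancel₀ htc, one_smul, ← add_assoc, ← add_smul]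
      simp
    rw [hρs]
    exact hv.classicalA_sum hB (hv.posSemidef_of_sum (hρs ▸ hρ.1))
  · rintro ⟨v, hv, l, τ, hl, hτ, rfl⟩
    simp_rw [← kronecker_smul]
    rw [← hv.sum_proj_kronecker_smul_one_add]
    exact hv.classicalA_sum hB fun i => (PosSemidef.one.smul hc).add
      (((hτ i).1.smul (by exact_mod_cast hl i)).smul htn)
end
end
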